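/- Let A_• be a commutative ℕ-graded ring that is a ℤ-algebra generated by finitely many elements of degree 1, of Krull dimension d. Let M_• = ⊕_{n∈ℕ} M_n be a finitely generated graded A_•-module (so each M_n is a finitely generated ℤ-module). Let r ≥ d be an integer. Suppose given two families of Hilbertian seminorms: for each i ∈ ℕ and each n ∈ ℕ a Hilbertian seminorm ‖·‖_{i,n} on M_n ⊗ ℝ with ‖·‖_{i+1,n} ≤ ‖·‖_{i,n} for all i, n, and similarly a decreasing-in-j family ‖·‖′_{j,n}; assume they are mutually dominated: for every i there exist j and C > 0 with ‖·‖′_{j,n} ≤ C·‖·‖_{i,n} on M_n ⊗ ℝ for all n, and for every j there exist i and C > 0 with ‖·‖_{i,n} ≤ C·‖·‖′_{j,n} for all n. Then lim_{i→∞} liminf_{n→∞} (r!/n^r)·χ̂(M_n, ‖·‖_{i,n}) = lim_{j→∞} liminf_{n→∞} (r!/n^r)·χ̂(M_n, ‖·‖′_{j,n}), where both limits over i (resp. j) exist in ℝ ∪ {±∞} because the quantity χ̂(M_n, ‖·‖_{i,n}) is nondecreasing in i. -/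

import Mathlib

open scoped TensorProduct

/-- A function on `M ⊗ ℝ` (realized as `ℝ ⊗[ℤ] M`) is a *Hilbertian seminorm* if it is of the
form `x ↦ √(B x x)` for some positive semidefinite symmetric real bilinear form `B`. -/
def IsHilbertianSeminorm (M : Type*) [AddCommGroup M]
    (nrm : (ℝ ⊗[ℤ] M) → ℝ) : Prop :=
  ∃ B : (ℝ ⊗[ℤ] M) →ₗ[ℝ] (ℝ ⊗[ℤ] M) →ₗ[ℝ] ℝ,
    (∀ x y, B x y = B y x) ∧ (∀ x, 0 ≤ B x x) ∧ (∀ x, nrm x = Real.sqrt (B x x))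

/-- The polarization form of a Hilbertian seminorm on `M ⊗ ℝ`. -/
noncomputable def polarForm (M : Type*) [AddCommGroup M]
    (nrm : (ℝ ⊗[ℤ] M) → ℝ) (x y : ℝ ⊗[ℤ] M) : ℝ :=
  (nrm (x + y) ^ 2 - nrm x ^ 2 - nrm y ^ 2) / 2

/-- `v : Fin n → M` is a basis of `M` modulo its torsion submodule. -/
def IsBasisModTorsion (M : Type*) [AddCommGroup M]
    (n : ℕ) (v : Fin n → M) : Prop :=
  (∀ x : M, ∃ c : Fin n → ℤ, x - ∑ i, c i • v i ∈ Submodule.torsion ℤ M) ∧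
  (∀ c : Fin n → ℤ, (∑ i, c i • v i) ∈ Submodule.torsion ℤ M → c = 0)

/-- The arithmetic degree `χ̂(M, ‖·‖) ∈ ℝ ∪ {+∞}` of a finitely generated `ℤ`-module `M`
equipped with a Hilbertian seminorm `‖·‖` on `M ⊗ ℝ`: it equals `0` if `M = 0`, `+∞` if the
seminorm is not definite, and `- log covol(M, ‖·‖) + log #M_tor` otherwise; here the covolume
is computed as the square root of the Gram determinant of a basis of `M` modulo torsion
(the bilinear form being recovered from the seminorm by polarization). -/
noncomputable def chiHat (M : Type*) [AddCommGroup M]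
    (nrm : (ℝ ⊗[ℤ] M) → ℝ) : EReal := by
  classical
  by_cases hM : Subsingleton M
  · exact 0
  by_cases hdef : ∃ x : ℝ ⊗[ℤ] M, x ≠ 0 ∧ nrm x = 0
  · exact ⊤
  by_cases hb : ∃ (n : ℕ) (v : Fin n → M), IsBasisModTorsion M n v
  · exact
      let n := hb.choose
      let v := hb.choose_spec.choose
      (((- (1 / 2 : ℝ)) * Real.log
          ((Matrix.of fun i j : Fin n =>
            polarForm M nrm ((1 : ℝ) ⊗ₜ[ℤ] v i) ((1 : ℝ) ⊗ₜ[ℤ] v j)).det)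
        + Real.log (Nat.card (Submodule.torsion ℤ M)) : ℝ) : EReal)
  · exact 0

theorem LinearIndependent.one_tmul_of_flat {R S M ι : Type*} [CommRing R] [CommRing S]
    [Algebra R S] [Module.Flat R S] [AddCommGroup M] [Module R M] {v : ι → M}
    (hv : LinearIndependent R v) : LinearIndependent S fun i => (1 : S) ⊗ₜ[R] v i := by
  have h : Function.Injective ((Finsupp.linearCombination R v).baseChange S) :=
    Module.Flat.lTensor_preserves_injective_linearMap (M := S) _ hv
  have := ((Finsupp.basisSingleOne (R := R) (ι := ι)).baseChange S).linearIndependent.map' _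
    (LinearMap.ker_eq_bot.mpr h)
  simpa [Function.comp_def] using this

instance Int.isJacobsonRing : IsJacobsonRing ℤ := by
  rw [isJacobsonRing_iff_prime_eq]
  intro P hP
  by_cases h : P = ⊥
  · subst h
    refine le_antisymm (fun x hx => ?_) Ideal.le_jacobson
    have := Ideal.mem_jacobson_bot.mp hx (3 * x)
    rw [Int.isUnit_iff] at this
    rw [Ideal.mem_bot]
    by_contra h0
    have : 0 < x * x := mul_self_pos.mpr h0
    grind
  · have := hP.isMaximal h
    exact Ideal.jacobson_eq_self_of_isMaximal

theorem not_isMaximal_of_comap_eq_bot {A : Type*} [CommRing A] [Algebra.FiniteType ℤ A]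
    (P : Ideal A) (hP : P.comap (algebraMap ℤ A) = ⊥) : ¬ P.IsMaximal := by
  intro hm
  let := Ideal.Quotient.field P
  have := finite_of_finite_type_of_isJacobsonRing ℤ (A ⧸ P)
  refine Int.not_isField (isField_of_isIntegral_of_isField (S := A ⧸ P) ?_ (Field.toIsField _))
  rw [RingHom.injective_iff_ker_eq_bot, ← hP]
  ext x
  rw [RingHom.mem_ker, Ideal.mem_comap, ← Ideal.Quotient.eq_zero_iff_mem]
  rfl

theorem add_one_le_ringKrullDim_of_le_ringKrullDim_rat_tensor (A : Type*) [CommRing A]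
    [Algebra.FiniteType ℤ A] {n : ℕ} (h : (n : WithBot ℕ∞) ≤ ringKrullDim (ℚ ⊗[ℤ] A)) :
    ((n + 1 : ℕ) : WithBot ℕ∞) ≤ ringKrullDim A := by
  obtain ⟨l, hl⟩ := Order.le_krullDim_iff.mp h
  let : Algebra A (ℚ ⊗[ℤ] A) := Algebra.TensorProduct.rightAlgebra
  let f : A →+* ℚ ⊗[ℤ] A := algebraMap A _
  have hmono : StrictMono (PrimeSpectrum.comap f) := by
    refine Monotone.strictMono_of_injective (fun p q hpq => Ideal.comap_mono hpq) ?_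
    exact PrimeSpectrum.localization_comap_injective _
      (Algebra.algebraMapSubmonoid A (nonZeroDivisors ℤ))
  let L := l.map _ hmono
  have hlast : ¬ L.last.asIdeal.IsMaximal := by
    apply not_isMaximal_of_comap_eq_bot
    have hL : L.last.asIdeal = l.last.asIdeal.comap f := by
      simp [L, LTSeries.last_map]
    rw [hL, Ideal.comap_comap, Subsingleton.elim (f.comp (algebraMap ℤ A))
      ((algebraMap ℚ (ℚ ⊗[ℤ] A)).comp (algebraMap ℤ ℚ)), ← Ideal.comap_comap]
    have : l.last.asIdeal.comap (algebraMap ℚ (ℚ ⊗[ℤ] A)) = ⊥ := Ideal.eq_bot_of_prime _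
    rw [this]
    ext x
    simp
  obtain ⟨m, hm, hle⟩ := Ideal.exists_le_maximal _ L.last.isPrime.ne_top
  have hlt : L.last < ⟨m, hm.isPrime⟩ :=
    lt_of_le_of_ne hle fun e => hlast (by rw [e]; exact hm)
  refine Order.le_krullDim_iff.mpr ⟨L.snoc _ hlt, ?_⟩
  simp [L, hl]

theorem le_ringKrullDim_of_isIntegral {K B : Type*} [Field K] [CommRing B] [Algebra K B] {s : ℕ}
    (g : MvPolynomial (Fin s) K →ₐ[K] B) (hg : Function.Injective g) (hi : g.IsIntegral) :
    (s : WithBot ℕ∞) ≤ ringKrullDim B := by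
  algebraize [g.toRingHom]
  have hs : ((s : ℕ) : WithBot ℕ∞) ≤ ringKrullDim (MvPolynomial (Fin s) K) := by
    rw [MvPolynomial.ringKrullDim_of_isNoetherianRing]
    simp
  obtain ⟨l, hl⟩ := Order.le_krullDim_iff.mp hs
  obtain ⟨q, hq⟩ := RingHom.IsIntegral.comap_surjective (f := g.toRingHom) hi hg l.head
  have : q.asIdeal.LiesOver l.head.asIdeal := ⟨by rw [← hq]; rfl⟩
  obtain ⟨L, hL, -⟩ := Ideal.exists_ltSeries_of_hasGoingUp l q.asIdeal
  exact Order.le_krullDim_iff.mpr ⟨L, hL.trans hl⟩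

theorem MvPolynomial.map_mul_mem_span_monomials {K B : Type*} [Field K] [CommRing B]
    [Algebra K B] {s m : ℕ} (g : MvPolynomial (Fin s) K →ₐ[K] B) (b : Fin m → B) {E : ℕ}
    (p : MvPolynomial (Fin s) K) (hp : ∀ i, p.degreeOf i ≤ E) (k : Fin m) :
    g p * b k ∈ Submodule.span K (Set.range fun x : (Fin s → Fin (E + 1)) × Fin m =>
      g (monomial (Finsupp.equivFunOnFinite.symm fun i => (x.1 i : ℕ)) 1) * b x.2) := by
  rw [p.as_sum, map_sum, Finset.sum_mul]
  refine Submodule.sum_mem _ fun α hα => ?_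
  rw [← mul_one (p.coeff α), ← smul_eq_mul (a := p.coeff α), ← smul_monomial, map_smul,
    smul_mul_assoc]
  refine Submodule.smul_mem _ _ (Submodule.subset_span ⟨⟨fun i => ⟨α i, ?_⟩, k⟩, ?_⟩)
  · exact Nat.lt_succ_of_le (degreeOf_le_iff.mp (hp i) α hα)
  · dsimp only
    congr 3
    ext i
    simp

theorem exists_finite_filtration_of_finite {K B : Type*} [Field K] [CommRing B] [Algebra K B]
    {s : ℕ} (g : MvPolynomial (Fin s) K →ₐ[K] B) (hg : g.Finite) (W : Finset B) :
    ∃ (c : ℕ) (F : ℕ → Submodule K B),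
      (∀ n, ∃ G : Finset B, G.card ≤ c * (n + 1) ^ s ∧ Submodule.span K (G : Set B) = F n) ∧
      1 ∈ F 0 ∧ Monotone F ∧ ∀ n, ∀ w ∈ W, ∀ x ∈ F n, w * x ∈ F (n + 1) := by
  classical
  algebraize [g.toRingHom]
  have : Module.Finite (MvPolynomial (Fin s) K) B := hg
  obtain ⟨m, b, hb⟩ := Module.Finite.exists_fin (R := MvPolynomial (Fin s) K) (M := B)
  have key : ∀ x : B, ∃ p : Fin m → MvPolynomial (Fin s) K, x = ∑ l, g (p l) * b l := by
    intro x
    have hx : x ∈ Submodule.span (MvPolynomial (Fin s) K) (Set.range b) := hb ▸ Submodule.mem_top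
    obtain ⟨p, rfl⟩ := (Submodule.mem_span_range_iff_exists_fun _).mp hx
    exact ⟨p, rfl⟩
  choose p hp using key
  let D : ℕ := (∑ l, (p 1 l).totalDegree) + ∑ w ∈ W, ∑ k, ∑ l, (p (w * b k) l).totalDegree
  have hD1 : ∀ l i, (p 1 l).degreeOf i ≤ D := fun l i => by
    refine (MvPolynomial.degreeOf_le_totalDegree _ _).trans (le_trans ?_ (Nat.le_add_right _ _))
    exact Finset.single_le_sum (f := fun l => (p 1 l).totalDegree) (fun _ _ => Nat.zero_le _)
      (Finset.mem_univ l)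
  have hDw : ∀ w ∈ W, ∀ k l i, (p (w * b k) l).degreeOf i ≤ D := fun w hw k l i => by
    refine (MvPolynomial.degreeOf_le_totalDegree _ _).trans (le_trans ?_ (Nat.le_add_left _ _))
    refine le_trans ?_ (Finset.single_le_sum
      (f := fun w => ∑ k, ∑ l, (p (w * b k) l).totalDegree) (fun _ _ => Nat.zero_le _) hw)
    refine le_trans ?_ (Finset.single_le_sum
      (f := fun k => ∑ l, (p (w * b k) l).totalDegree) (fun _ _ => Nat.zero_le _)
      (Finset.mem_univ k))
    exact Finset.single_le_sum (f := fun l => (p (w * b k) l).totalDegree)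
      (fun _ _ => Nat.zero_le _) (Finset.mem_univ l)
  let v (E : ℕ) (x : (Fin s → Fin (E + 1)) × Fin m) : B :=
      g (MvPolynomial.monomial (Finsupp.equivFunOnFinite.symm fun i => (x.1 i : ℕ)) 1) * b x.2
  have hdeg : ∀ E (x : (Fin s → Fin (E + 1)) × Fin m) i, (MvPolynomial.monomial
      (Finsupp.equivFunOnFinite.symm fun i => (x.1 i : ℕ)) (1 : K)).degreeOf i ≤ E := by
    intro E x i
    rw [MvPolynomial.degreeOf_monomial_eq _ _ one_ne_zero]
    exact Nat.le_of_lt_succ (x.1 i).2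
  refine ⟨m * (D + 1) ^ s, fun n => Submodule.span K (Set.range (v (D * (n + 1)))), ?_, ?_, ?_, ?_⟩
  · intro n
    refine ⟨Finset.univ.image (v (D * (n + 1))), Finset.card_image_le.trans ?_, by simp⟩
    simp only [Finset.card_univ, Fintype.card_prod, Fintype.card_fun, Fintype.card_fin]
    rw [mul_comm, mul_assoc, ← mul_pow]
    gcongr
    nlinarith
  · have h1 : (1 : B) ∈ Submodule.span K (Set.range (v (D * (0 + 1)))) := by
      rw [hp 1]
      refine Submodule.sum_mem _ fun l _ => ?_
      exact MvPolynomial.map_mul_mem_span_monomials g b _ (fun i => by simpa using hD1 l i) l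
    exact h1
  · intro n n' h
    refine Submodule.span_le.mpr ?_
    rintro _ ⟨x, rfl⟩
    exact MvPolynomial.map_mul_mem_span_monomials g b _
      (fun i => (hdeg _ x i).trans (by gcongr)) x.2
  · intro n w hw x hx
    induction hx using Submodule.span_induction with
    | zero => simp
    | add x y _ _ hx hy => rw [mul_add]; exact add_mem hx hy
    | smul a x _ hx => rw [mul_smul_comm]; exact Submodule.smul_mem _ _ hx
    | mem y hy =>
      obtain ⟨x, rfl⟩ := hy
      dsimp only [v]
      rw [mul_left_comm, hp (w * b x.2), Finset.mul_sum]
      refine Submodule.sum_mem _ fun l _ => ?_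
      rw [← mul_assoc, ← map_mul]
      refine MvPolynomial.map_mul_mem_span_monomials g b _ (fun i => ?_) l
      refine (MvPolynomial.degreeOf_mul_le _ _ _).trans ?_
      have := hdeg _ x i
      have := hDw w hw x.2 l i
      linarith

theorem DirectSum.decompose_smul_mem {A M σ τ : Type*} [Semiring A] [AddCommMonoid M] [Module A M]
    [SetLike σ A] [AddSubmonoidClass σ A] [SetLike τ M] [AddSubmonoidClass τ M]
    (𝒜 : ℕ → σ) (ℳ : ℕ → τ) [DirectSum.Decomposition 𝒜] [DirectSum.Decomposition ℳ]
    [SetLike.GradedSMul 𝒜 ℳ] (N : AddSubmonoid M) (a : A) (x : M) (n : ℕ)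
    (h : ∀ i j, i + j = n →
      (DirectSum.decompose 𝒜 a i : A) • (DirectSum.decompose ℳ x j : M) ∈ N) :
    (DirectSum.decompose ℳ (a • x) n : M) ∈ N := by
  classical
  rw [← DirectSum.sum_support_decompose 𝒜 a, ← DirectSum.sum_support_decompose ℳ x,
    Finset.sum_smul]
  simp only [Finset.smul_sum, DirectSum.decompose_sum, DirectSum.sum_apply,
    AddSubmonoidClass.coe_finsetSum]
  refine sum_mem fun i _ => sum_mem fun j _ => ?_
  have hm : (DirectSum.decompose 𝒜 a i : A) • (DirectSum.decompose ℳ x j : M) ∈ ℳ (i + j) :=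
    SetLike.GradedSMul.smul_mem (A := 𝒜) (B := ℳ) (SetLike.coe_mem (decompose 𝒜 a i))
      (SetLike.coe_mem (decompose ℳ x j))
  by_cases hij : i + j = n
  · subst hij
    rw [DirectSum.decompose_of_mem_same _ hm]
    exact h i j rfl
  · rw [DirectSum.decompose_of_mem_ne _ hm hij]
    exact zero_mem _

theorem tmul_decompose_mem_filtration {A : Type*} [CommRing A] (𝒜 : ℕ → AddSubgroup A)
    [GradedRing 𝒜] {S : Set A} (hS1 : S ⊆ (𝒜 1 : Set A)) (hS : Algebra.adjoin ℤ S = ⊤)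
    (F : ℕ → Submodule ℚ (ℚ ⊗[ℤ] A))
    (hF : ∀ n, ∀ w ∈ S, ∀ x ∈ F n, ((1 : ℚ) ⊗ₜ[ℤ] w) * x ∈ F (n + 1)) (a : A) (i n : ℕ)
    (x : ℚ ⊗[ℤ] A) (hx : x ∈ F n) :
    ((1 : ℚ) ⊗ₜ[ℤ] (DirectSum.decompose 𝒜 a i : A)) * x ∈ F (n + i) := by
  have ha : a ∈ Algebra.adjoin ℤ S := hS ▸ Algebra.mem_top
  induction ha using Algebra.adjoin_induction generalizing i n x with
  | mem w hw =>
    by_cases hi : 1 = i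
    · subst hi
      rw [DirectSum.decompose_of_mem_same 𝒜 (hS1 hw)]
      exact hF n w hw x hx
    · rw [DirectSum.decompose_of_mem_ne 𝒜 (hS1 hw) hi]
      simp
  | algebraMap z =>
    have hz : algebraMap ℤ A z ∈ 𝒜 0 := by
      rw [eq_intCast]; exact SetLike.intCast_mem_graded 𝒜 z
    by_cases hi : 0 = i
    · subst hi
      rw [DirectSum.decompose_of_mem_same 𝒜 hz, Algebra.algebraMap_eq_smul_one,
        TensorProduct.tmul_smul, ← Algebra.TensorProduct.one_def, smul_mul_assoc, one_mul]
      exact zsmul_mem hx z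
    · rw [DirectSum.decompose_of_mem_ne 𝒜 hz hi]
      simp
  | add a b _ _ ha hb =>
    rw [DirectSum.decompose_add, DirectSum.add_apply, AddMemClass.coe_add, TensorProduct.tmul_add,
      add_mul]
    exact add_mem (ha i n x hx) (hb i n x hx)
  | mul a b _ _ ha hb =>
    let f : A →+ ℚ ⊗[ℤ] A := (AddMonoidHom.mulRight x).comp
      (TensorProduct.mk ℤ ℚ A 1).toAddMonoidHom
    refine DirectSum.decompose_smul_mem 𝒜 𝒜 ((F (n + i)).toAddSubmonoid.comap f) a b i ?_
    intro j k hjk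
    have := ha j (n + k) _ (hb k n x hx)
    rw [← mul_assoc, Algebra.TensorProduct.tmul_mul_tmul, one_mul] at this
    have e : n + k + j = n + i := by omega
    rw [e] at this
    exact this

theorem exists_finite_span_tmul_decompose {A : Type*} [CommRing A] (𝒜 : ℕ → AddSubgroup A)
    [GradedRing 𝒜] (S : Finset A) (hS1 : (S : Set A) ⊆ (𝒜 1 : Set A))
    (hS : Algebra.adjoin ℤ (S : Set A) = ⊤)
    {M : Type*} [AddCommGroup M] [Module A M] [Module.Finite A M]
    (ℳ : ℕ → Submodule ℤ M) [DirectSum.Decomposition ℳ] [SetLike.GradedSMul 𝒜 ℳ]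
    {s : ℕ} (g : MvPolynomial (Fin s) ℚ →ₐ[ℚ] ℚ ⊗[ℤ] A) (hg : g.Finite) :
    ∃ c : ℕ, ∀ n, ∃ G : Finset (ℚ ⊗[ℤ] M), G.card ≤ c * (n + 1) ^ s ∧
      ∀ x ∈ ℳ n, (1 : ℚ) ⊗ₜ[ℤ] x ∈ Submodule.span ℚ (G : Set (ℚ ⊗[ℤ] M)) := by
  classical
  obtain ⟨c, F, hcard, hF1, hmono, hF⟩ := exists_finite_filtration_of_finite g hg
    (S.image fun w => (1 : ℚ) ⊗ₜ[ℤ] w)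
  obtain ⟨T, hT⟩ := Module.finite_def.mp (inferInstance : Module.Finite A M)
  have hA := tmul_decompose_mem_filtration 𝒜 hS1 hS F
    fun n w hw x hx => hF n _ (Finset.mem_image_of_mem _ hw) x hx
  let T' : Finset M := T.biUnion fun t =>
    (DirectSum.decompose ℳ t).support.image fun j => (DirectSum.decompose ℳ t j : M)
  let L (t : M) : ℚ ⊗[ℤ] A →ₗ[ℚ] ℚ ⊗[ℤ] M :=
    ((LinearMap.toSpanSingleton A M t).restrictScalars ℤ).baseChange ℚ
  have hL : ∀ t a, L t ((1 : ℚ) ⊗ₜ[ℤ] a) = (1 : ℚ) ⊗ₜ[ℤ] (a • t) := fun t a => by simp [L]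
  let U (n : ℕ) : Submodule ℚ (ℚ ⊗[ℤ] M) := ⨆ t ∈ T', (F n).map (L t)
  have hUA : ∀ (a : A) i n, ∀ x ∈ U n,
      (DistribSMul.toLinearMap ℤ M (DirectSum.decompose 𝒜 a i : A)).baseChange ℚ x ∈
        U (n + i) := by
    intro a i n
    change U n ≤ (U (n + i)).comap _
    refine iSup₂_le fun t ht => ?_
    rintro _ ⟨f, hf, rfl⟩
    have h1 : (DistribSMul.toLinearMap ℤ M (DirectSum.decompose 𝒜 a i : A)).baseChange ℚ ∘ₗ L t =
        L t ∘ₗ LinearMap.mulLeft ℚ ((1 : ℚ) ⊗ₜ[ℤ] (DirectSum.decompose 𝒜 a i : A)) := by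
      ext b
      simp [L, mul_smul]
    have h2 := LinearMap.congr_fun h1 f
    simp only [LinearMap.comp_apply] at h2
    rw [Submodule.mem_comap, h2]
    exact Submodule.mem_iSup_of_mem t (Submodule.mem_iSup_of_mem ht ⟨_, hA a i n f hf, rfl⟩)
  have hQ : ∀ x : M, ∀ n, (1 : ℚ) ⊗ₜ[ℤ] (DirectSum.decompose ℳ x n : M) ∈ U n := by
    intro x
    have hx : x ∈ Submodule.span A (T : Set M) := hT ▸ Submodule.mem_top
    induction hx using Submodule.span_induction with
    | zero => simp
    | add x y _ _ hx hy =>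
      intro n
      rw [DirectSum.decompose_add, DirectSum.add_apply, Submodule.coe_add, TensorProduct.tmul_add]
      exact add_mem (hx n) (hy n)
    | mem t ht =>
      intro n
      by_cases h0 : DirectSum.decompose ℳ t n = 0
      · simp [h0]
      refine Submodule.mem_iSup_of_mem (DirectSum.decompose ℳ t n : M)
        (Submodule.mem_iSup_of_mem ?_ ⟨1, hmono (Nat.zero_le n) hF1, ?_⟩)
      · exact Finset.mem_biUnion.mpr ⟨t, ht, Finset.mem_image.mpr
          ⟨n, by simpa using h0, rfl⟩⟩
      · rw [Algebra.TensorProduct.one_def, hL, one_smul]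
    | smul a x _ hx =>
      intro n
      refine DirectSum.decompose_smul_mem 𝒜 ℳ ((U n).toAddSubmonoid.comap
        (TensorProduct.mk ℤ ℚ M 1).toAddMonoidHom) a x n ?_
      intro i j hij
      have := hUA a i j _ (hx j)
      rw [add_comm, hij] at this
      simpa using this
  choose G hGc hG using hcard
  refine ⟨T'.card * c, fun n => ⟨T'.biUnion fun t => (G n).image (L t), ?_, fun x hx => ?_⟩⟩
  · refine (Finset.card_biUnion_le_card_mul _ _ (c * (n + 1) ^ s) fun t _ => ?_).trans
      (mul_assoc _ _ _).ge
    exact Finset.card_image_le.trans (hGc n)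
  · have h := hQ x n
    rw [DirectSum.decompose_of_mem_same ℳ hx] at h
    refine (iSup₂_le fun t ht => ?_ : U n ≤ _) h
    rw [← hG n, Submodule.map_span]
    refine Submodule.span_mono ?_
    rintro _ ⟨y, hy, rfl⟩
    exact Finset.mem_coe.mpr (Finset.mem_biUnion.mpr ⟨t, ht, Finset.mem_image_of_mem _ hy⟩)

theorem IsBasisModTorsion.linearIndependent {M : Type*} [AddCommGroup M] {k : ℕ} {v : Fin k → M}
    (hv : IsBasisModTorsion M k v) : LinearIndependent ℤ v :=
  Fintype.linearIndependent_iff.mpr fun c hc i =>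
    congrFun (hv.2 c (hc ▸ Submodule.zero_mem _)) i

theorem exists_basisModTorsion_card_le {A : Type*} [CommRing A] (𝒜 : ℕ → AddSubgroup A)
    [GradedRing 𝒜]
    (hgen : ∃ s : Finset A, (↑s : Set A) ⊆ (𝒜 1 : Set A) ∧ Algebra.adjoin ℤ (↑s : Set A) = ⊤)
    {d : ℕ} (hdim : ringKrullDim A = d)
    {M : Type*} [AddCommGroup M] [Module A M] [Module.Finite A M]
    (ℳ : ℕ → Submodule ℤ M) [DirectSum.Decomposition ℳ] [SetLike.GradedSMul 𝒜 ℳ]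
    {r : ℕ} (hrd : d ≤ r) :
    ∃ K : ℕ → ℕ, (∀ n k (v : Fin k → ℳ n), IsBasisModTorsion (ℳ n) k v → k ≤ K n) ∧
      Filter.Tendsto (fun n => (K n : ℝ) / (n : ℝ) ^ r) Filter.atTop (nhds 0) := by
  obtain ⟨S, hS1, hS⟩ := hgen
  have hft : Algebra.FiniteType ℤ A := ⟨⟨S, hS⟩⟩
  have hli : ∀ n k (v : Fin k → ℳ n), IsBasisModTorsion (ℳ n) k v →
      LinearIndependent ℚ fun i => (1 : ℚ) ⊗ₜ[ℤ] (v i : M) := fun n k v hv =>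
    (hv.linearIndependent.map' (ℳ n).subtype (Submodule.ker_subtype _)).one_tmul_of_flat
  cases subsingleton_or_nontrivial (ℚ ⊗[ℤ] A) with
  | inl h =>
    refine ⟨fun _ => 0, fun n k v hv => ?_, by simp⟩
    rcases Nat.eq_zero_or_pos k with hk | hk
    · exact hk.le
    · have hz : ∀ x : M, (1 : ℚ) ⊗ₜ[ℤ] x = 0 := fun x => by
        have := congrArg (((LinearMap.toSpanSingleton A M x).restrictScalars ℤ).baseChange ℚ)
          (Subsingleton.elim ((1 : ℚ) ⊗ₜ[ℤ] (1 : A)) 0)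
        simpa using this
      exact absurd (hz _) ((hli n k v hv).ne_zero ⟨0, hk⟩)
  | inr h =>
    obtain ⟨s, g, hginj, hgfin⟩ := exists_finite_inj_algHom_of_fg ℚ (ℚ ⊗[ℤ] A)
    have hs := add_one_le_ringKrullDim_of_le_ringKrullDim_rat_tensor A
      (le_ringKrullDim_of_isIntegral g hginj hgfin.to_isIntegral)
    rw [hdim] at hs
    have hsr : s + 1 ≤ r := le_trans (by exact_mod_cast hs) hrd
    obtain ⟨c, hc⟩ := exists_finite_span_tmul_decompose 𝒜 S hS1 hS ℳ g hgfin
    refine ⟨fun n => c * (n + 1) ^ s, fun n k v hv => ?_, ?_⟩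
    · obtain ⟨G, hGc, hG⟩ := hc n
      refine le_trans ?_ hGc
      have h1 := finrank_span_eq_card (hli n k v hv)
      rw [Fintype.card_fin] at h1
      rw [← h1]
      refine (Submodule.finrank_mono (Submodule.span_le.mpr ?_)).trans
        (finrank_span_finset_le_card G)
      rintro _ ⟨i, rfl⟩
      exact hG _ (v i).2
    · refine squeeze_zero' (g := fun n : ℕ => (c * 2 ^ s : ℝ) / n)
        (.of_forall fun n => by positivity) ?_ (tendsto_const_div_atTop_nhds_zero_nat _)
      filter_upwards [Filter.eventually_ge_atTop 1] with n hn
      have hn' : (1 : ℝ) ≤ n := by exact_mod_cast hn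
      rw [div_le_div_iff₀ (by positivity) (by positivity)]
      push_cast
      calc (c * (n + 1) ^ s * n : ℝ) ≤ c * (2 * n) ^ s * n := by gcongr; linarith
        _ = c * 2 ^ s * n ^ (s + 1) := by ring
        _ ≤ c * 2 ^ s * n ^ r := by gcongr

theorem Matrix.PosSemidef.one_le_det_one_add {n : Type*} [Fintype n] [DecidableEq n]
    {N : Matrix n n ℝ} (hN : N.PosSemidef) : 1 ≤ (1 + N).det := by
  have h : (1 + N).det = ∏ i, (1 + hN.1.eigenvalues i) := by
    conv_lhs => rw [hN.1.spectral_theorem,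
      ← map_one (Unitary.conjStarAlgAut ℝ _ hN.1.eigenvectorUnitary), ← map_add,
      Unitary.conjStarAlgAut_apply, Matrix.det_mul_comm, ← mul_assoc]
    simp [← Matrix.diagonal_one, Matrix.diagonal_add]
  rw [h]
  calc (1 : ℝ) = ∏ _i : n, 1 := Finset.prod_const_one.symm
    _ ≤ _ := Finset.prod_le_prod (fun _ _ => zero_le_one) fun i _ => by
      linarith [hN.eigenvalues_nonneg i]

open scoped MatrixOrder in
theorem Matrix.PosDef.det_le_det {n : Type*} [Fintype n] [DecidableEq n]
    {P Q : Matrix n n ℝ} (hP : P.PosDef) (hPQ : (Q - P).PosSemidef) : P.det ≤ Q.det := by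
  obtain ⟨S, hS, hSP⟩ : ∃ S : Matrix n n ℝ, S.IsHermitian ∧ S * S = P :=
    ⟨CFC.sqrt P, (Matrix.nonneg_iff_posSemidef.mp (CFC.sqrt_nonneg P)).isHermitian,
      CFC.sqrt_mul_sqrt_self P hP.posSemidef.nonneg⟩
  have hdet : S.det * S.det = P.det := by rw [← Matrix.det_mul, hSP]
  have hu : IsUnit S.det := by
    rw [isUnit_iff_ne_zero]
    intro h
    have := hP.det_pos
    simp [← hdet, h] at this
  have hN := hPQ.conjTranspose_mul_mul_same S⁻¹
  have hN1 := hN.one_le_det_one_add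
  have hQ : Q = S * (1 + S⁻¹.conjTranspose * (Q - P) * S⁻¹) * S := by
    rw [Matrix.conjTranspose_nonsing_inv, hS.eq, mul_add, add_mul, mul_one, hSP, ← mul_assoc,
      ← mul_assoc, Matrix.mul_nonsing_inv _ hu, one_mul, mul_assoc, Matrix.nonsing_inv_mul _ hu,
      mul_one, add_sub_cancel]
  rw [hQ, Matrix.det_mul, Matrix.det_mul, mul_right_comm, hdet]
  exact le_mul_of_one_le_right hP.det_pos.le hN1

theorem LinearMap.dotProduct_gram_mulVec {V ι : Type*} [AddCommGroup V] [Module ℝ V] [Fintype ι]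
    (B : V →ₗ[ℝ] V →ₗ[ℝ] ℝ) (w : ι → V) (x : ι → ℝ) :
    x ⬝ᵥ ((Matrix.of fun i j => B (w i) (w j)).mulVec x) =
      B (∑ i, x i • w i) (∑ i, x i • w i) := by
  simp only [dotProduct, Matrix.mulVec, Matrix.of_apply, map_sum, map_smul, LinearMap.sum_apply,
    LinearMap.smul_apply, smul_eq_mul, Finset.mul_sum]
  rw [Finset.sum_comm]
  exact Finset.sum_congr rfl fun _ _ => Finset.sum_congr rfl fun _ _ => by ring

theorem polarForm_eq {M : Type*} [AddCommGroup M] {nrm : (ℝ ⊗[ℤ] M) → ℝ}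
    {B : (ℝ ⊗[ℤ] M) →ₗ[ℝ] (ℝ ⊗[ℤ] M) →ₗ[ℝ] ℝ} (hsymm : ∀ x y, B x y = B y x)
    (hnrm : ∀ x, nrm x ^ 2 = B x x) (x y : ℝ ⊗[ℤ] M) : polarForm M nrm x y = B x y := by
  simp only [polarForm, hnrm, map_add, LinearMap.add_apply, hsymm y x]
  ring

theorem log_det_gram_le {V : Type*} [AddCommGroup V] [Module ℝ V] {k : ℕ}
    {B B' : V →ₗ[ℝ] V →ₗ[ℝ] ℝ} (hB : ∀ x y, B x y = B y x) (hB' : ∀ x y, B' x y = B' y x)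
    (hpos' : ∀ x, x ≠ 0 → 0 < B' x x) {C : ℝ} (hC : 0 < C)
    (hle : ∀ x, B' x x ≤ C ^ 2 * B x x) {w : Fin k → V} (hw : LinearIndependent ℝ w) :
    Real.log (Matrix.of fun i j => B' (w i) (w j)).det ≤
      2 * k * Real.log C + Real.log (Matrix.of fun i j => B (w i) (w j)).det := by
  have hP : (Matrix.of fun i j => B' (w i) (w j)).PosDef := by
    refine .of_dotProduct_mulVec_pos (Matrix.ext fun i j => hB' _ _) fun x hx => ?_
    rw [star_trivial, LinearMap.dotProduct_gram_mulVec]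
    refine hpos' _ fun h => hx ?_
    exact funext (Fintype.linearIndependent_iff.mp hw x h)
  have hPQ : (C ^ 2 • (Matrix.of fun i j => B (w i) (w j)) -
      Matrix.of fun i j => B' (w i) (w j)).PosSemidef := by
    refine .of_dotProduct_mulVec_nonneg (Matrix.ext fun i j => ?_) fun x => ?_
    · simp [hB (w i) (w j), hB' (w i) (w j)]
    · rw [star_trivial, Matrix.sub_mulVec, Matrix.smul_mulVec, dotProduct_sub, dotProduct_smul,
        LinearMap.dotProduct_gram_mulVec, LinearMap.dotProduct_gram_mulVec, smul_eq_mul]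
      exact sub_nonneg.mpr (hle _)
  have hdet := hP.det_le_det hPQ
  rw [Matrix.det_smul, Fintype.card_fin] at hdet
  have h0 := hP.det_pos
  have h1 : 0 < (Matrix.of fun i j => B (w i) (w j)).det :=
    pos_of_mul_pos_right (h0.trans_le hdet) (by positivity)
  refine (Real.log_le_log h0 hdet).trans_eq ?_
  rw [Real.log_mul (by positivity) h1.ne', Real.log_pow, Real.log_pow]
  push_cast
  ring

theorem chiHat_le_add {M : Type*} [AddCommGroup M] {p q : (ℝ ⊗[ℤ] M) → ℝ}
    (hp : IsHilbertianSeminorm M p) (hq : IsHilbertianSeminorm M q) {C : ℝ} (hC : 1 ≤ C)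
    (hle : ∀ x, q x ≤ C * p x) {K : ℕ}
    (hK : ∀ k (v : Fin k → M), IsBasisModTorsion M k v → k ≤ K) :
    chiHat M p ≤ chiHat M q + ((K * Real.log C : ℝ) : EReal) := by
  have hlog : 0 ≤ Real.log C := Real.log_nonneg hC
  have hKC : (0 : EReal) ≤ ((K * Real.log C : ℝ) : EReal) := by
    exact_mod_cast (by positivity : 0 ≤ K * Real.log C)
  obtain ⟨B, hB, hBn, hpB⟩ := hp
  obtain ⟨B', hB', hBn', hqB⟩ := hq
  have hp2 : ∀ x, p x ^ 2 = B x x := fun x => by rw [hpB, Real.sq_sqrt (hBn x)]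
  have hq2 : ∀ x, q x ^ 2 = B' x x := fun x => by rw [hqB, Real.sq_sqrt (hBn' x)]
  have hp0 : ∀ x, 0 ≤ p x := fun x => by rw [hpB]; positivity
  have hq0 : ∀ x, 0 ≤ q x := fun x => by rw [hqB]; positivity
  by_cases hM : Subsingleton M
  · simpa [chiHat, hM] using hKC
  by_cases hdq : ∃ x : ℝ ⊗[ℤ] M, x ≠ 0 ∧ q x = 0
  · have : chiHat M q = ⊤ := by rw [chiHat, dif_neg hM, dif_pos hdq]
    rw [this, EReal.top_add_coe]
    exact le_top
  have hdp : ¬ ∃ x : ℝ ⊗[ℤ] M, x ≠ 0 ∧ p x = 0 := fun ⟨x, hx, hx0⟩ =>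
    hdq ⟨x, hx, le_antisymm (by simpa [hx0] using hle x) (hq0 x)⟩
  rw [chiHat, chiHat, dif_neg hM, dif_neg hM, dif_neg hdq, dif_neg hdp]
  by_cases hb : ∃ (n : ℕ) (v : Fin n → M), IsBasisModTorsion M n v
  · rw [dif_pos hb, dif_pos hb, ← EReal.coe_add, EReal.coe_le_coe_iff]
    have hv := hb.choose_spec.choose_spec
    have hk : (hb.choose : ℝ) ≤ K := by exact_mod_cast hK _ _ hv
    have hmain := log_det_gram_le hB hB' (fun x hx => ?_) (zero_lt_one.trans_le hC)
      (fun x => ?_) (hv.linearIndependent.one_tmul_of_flat (S := ℝ))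
    · simp only [polarForm_eq hB hp2, polarForm_eq hB' hq2]
      have := mul_le_mul_of_nonneg_right hk hlog
      linarith
    · rw [← hq2]
      exact pow_pos ((hq0 x).lt_of_ne' fun h => hdq ⟨x, hx, h⟩) 2
    · rw [← hq2, ← hp2, ← mul_pow]
      exact pow_le_pow_left₀ (hq0 x) (hle x) 2
  · rw [dif_neg hb, dif_neg hb, zero_add]
    exact hKC

theorem iSup_liminf_chiHat_le {M : ℕ → Type*} [∀ n, AddCommGroup (M n)]
    {p q : ℕ → (n : ℕ) → (ℝ ⊗[ℤ] M n) → ℝ}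
    (hp : ∀ i n, IsHilbertianSeminorm (M n) (p i n))
    (hq : ∀ j n, IsHilbertianSeminorm (M n) (q j n))
    (hdom : ∀ i, ∃ j, ∃ C > (0 : ℝ), ∀ n x, q j n x ≤ C * p i n x) {r : ℕ} {K : ℕ → ℕ}
    (hK : ∀ n k (v : Fin k → M n), IsBasisModTorsion (M n) k v → k ≤ K n)
    (hlim : Filter.Tendsto (fun n => (K n : ℝ) / (n : ℝ) ^ r) Filter.atTop (nhds 0)) :
    (⨆ i : ℕ, Filter.liminf (fun n : ℕ =>
        (((r.factorial : ℝ) / (n : ℝ) ^ r : ℝ) : EReal) * chiHat (M n) (p i n)) Filter.atTop) ≤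
      ⨆ j : ℕ, Filter.liminf (fun n : ℕ =>
        (((r.factorial : ℝ) / (n : ℝ) ^ r : ℝ) : EReal) * chiHat (M n) (q j n)) Filter.atTop := by
  refine iSup_le fun i => ?_
  obtain ⟨j, C, hC, hle⟩ := hdom i
  refine le_iSup_of_le j ?_
  let e (n : ℕ) : EReal :=
    ((r.factorial * Real.log (max C 1) * ((K n : ℝ) / (n : ℝ) ^ r) : ℝ) : EReal)
  have he : Filter.Tendsto e Filter.atTop (nhds 0) := by
    have := hlim.const_mul (r.factorial * Real.log (max C 1))
    rw [mul_zero] at this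
    exact (continuous_coe_real_ereal.tendsto 0).comp this
  have hbound : ∀ n : ℕ,
      (((r.factorial : ℝ) / (n : ℝ) ^ r : ℝ) : EReal) * chiHat (M n) (p i n) ≤
      e n + (((r.factorial : ℝ) / (n : ℝ) ^ r : ℝ) : EReal) * chiHat (M n) (q j n) := by
    intro n
    have hx0 : ∀ x, 0 ≤ p i n x := fun x => by
      obtain ⟨B, -, -, h⟩ := hp i n
      rw [h]; positivity
    have h := chiHat_le_add (hp i n) (hq j n) (le_max_right C 1)
      (fun x => (hle n x).trans (mul_le_mul_of_nonneg_right (le_max_left _ _) (hx0 x))) (hK n)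
    have hc : (0 : EReal) ≤ (((r.factorial : ℝ) / (n : ℝ) ^ r : ℝ) : EReal) := by
      exact_mod_cast (by positivity : 0 ≤ (r.factorial : ℝ) / (n : ℝ) ^ r)
    refine (mul_le_mul_of_nonneg_left h hc).trans_eq ?_
    rw [EReal.left_distrib_of_nonneg_of_ne_top hc (EReal.coe_ne_top _), add_comm, ← EReal.coe_mul]
    congr 2
    ring
  refine (Filter.liminf_le_liminf (.of_forall hbound)).trans ?_
  refine (EReal.liminf_add_le ?_ ?_).trans_eq ?_ <;> simp [he.limsup_eq]

/-- **Independence of the lower arithmetic Hilbert invariant from the defining family of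
seminorms.** Let `A_•` be a commutative `ℕ`-graded ring, generated as a `ℤ`-algebra by finitely
many elements of degree `1`, of Krull dimension `d`, and let `M_• = ⊕ₙ Mₙ` be a finitely
generated graded `A_•`-module (each `Mₙ` a finitely generated `ℤ`-module). Let `r ≥ d`. If
`(‖·‖_{i,n})ᵢ` and `(‖·‖′_{j,n})ⱼ` are two decreasing families of Hilbertian seminorms on the
`Mₙ ⊗ ℝ` which mutually dominate each other, then
`lim_i liminf_n (r!/nʳ)·χ̂(Mₙ, ‖·‖_{i,n}) = lim_j liminf_n (r!/nʳ)·χ̂(Mₙ, ‖·‖′_{j,n})`,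
the limits over `i` (resp. `j`) being suprema of nondecreasing sequences in the extended
reals. -/
theorem lower_arithmetic_hilbert_invariant_independent
    (A : Type*) [CommRing A] (𝒜 : ℕ → AddSubgroup A) [GradedRing 𝒜]
    (hgen : ∃ s : Finset A, (↑s : Set A) ⊆ (𝒜 1 : Set A) ∧ Algebra.adjoin ℤ (↑s : Set A) = ⊤)
    (d : ℕ) (hdim : ringKrullDim A = d)
    (M : Type*) [AddCommGroup M] [Module A M] [Module.Finite A M]
    (ℳ : ℕ → Submodule ℤ M) [DirectSum.Decomposition ℳ] [SetLike.GradedSMul 𝒜 ℳ]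
    (hfin : ∀ n, Module.Finite ℤ ↥(ℳ n))
    (r : ℕ) (hrd : d ≤ r)
    (nrm nrm' : (i : ℕ) → (n : ℕ) → (ℝ ⊗[ℤ] ↥(ℳ n)) → ℝ)
    (hH : ∀ i n, IsHilbertianSeminorm ↥(ℳ n) (nrm i n))
    (hH' : ∀ j n, IsHilbertianSeminorm ↥(ℳ n) (nrm' j n))
    (hdec : ∀ i n x, nrm (i + 1) n x ≤ nrm i n x)
    (hdec' : ∀ j n x, nrm' (j + 1) n x ≤ nrm' j n x)
    (hdom : ∀ i, ∃ j, ∃ C > (0 : ℝ), ∀ n x, nrm' j n x ≤ C * nrm i n x)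
    (hdom' : ∀ j, ∃ i, ∃ C > (0 : ℝ), ∀ n x, nrm i n x ≤ C * nrm' j n x) :
    (⨆ i : ℕ, Filter.liminf
        (fun n : ℕ =>
          (((r.factorial : ℝ) / (n : ℝ) ^ r : ℝ) : EReal) * chiHat ↥(ℳ n) (nrm i n))
        Filter.atTop)
      = ⨆ j : ℕ, Filter.liminf
        (fun n : ℕ =>
          (((r.factorial : ℝ) / (n : ℝ) ^ r : ℝ) : EReal) * chiHat ↥(ℳ n) (nrm' j n))
        Filter.atTop := by
  obtain ⟨K, hK, hlim⟩ := exists_basisModTorsion_card_le 𝒜 hgen hdim ℳ hrd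
  exact le_antisymm (iSup_liminf_chiHat_le hH hH' hdom hK hlim)
    (iSup_liminf_chiHat_le hH' hH hdom' hK hlim)
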